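/- Let D be an integral domain that is a quotient of R_d = ℤ[u_1^{±1},...,u_d^{±1}] by a prime ideal of coheight at least 2 (i.e., Krull dimension of D is at least 2). Then for every nonzero proper principal ideal a ⊆ D, the quotient D/a is infinite. -/

import Mathlib

open Polynomial

lemma maximal_of_algebraic {A D : Type*} [CommRing A] [IsDomain A] [IsPrincipalIdealRing A]
    [CommRing D] [IsDomain D] [Algebra A D] (hinj : Function.Injective (algebraMap A D))
    [Algebra.IsAlgebraic A D] (q : Ideal D) [q.IsPrime] (hq : q ≠ ⊥) : q.IsMaximal := by
  classical
  have : FaithfulSMul A D := (faithfulSMul_iff_algebraMap_injective A D).mpr hinj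
  have : Module.IsTorsionFree A D := inferInstance
  let : NormalizedGCDMonoid A := Classical.choice inferInstance
  have hP : q.under A ≠ ⊥ := Ideal.comap_ne_bot_of_algebraic_mem (x := (Submodule.exists_mem_ne_zero_of_ne_bot hq).choose) (Submodule.exists_mem_ne_zero_of_ne_bot hq).choose_spec.2 (Submodule.exists_mem_ne_zero_of_ne_bot hq).choose_spec.1 (Algebra.IsAlgebraic.isAlgebraic _)
  have hPm : (q.under A).IsMaximal := IsPrime.to_maximal_ideal hP
  let := Ideal.Quotient.field (q.under A)
  have : Algebra.IsAlgebraic (A ⧸ q.under A) (D ⧸ q) := by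
    constructor
    intro x
    obtain ⟨x, rfl⟩ := Ideal.Quotient.mk_surjective x
    obtain ⟨f, hf, hx⟩ := Algebra.IsAlgebraic.isAlgebraic (R := A) x
    have h1 : aeval x f.primPart = 0 := by
      exact aeval_primPart_eq_zero hf hx
    refine ⟨f.primPart.map (algebraMap A _), ?_, ?_⟩
    · intro h0
      apply hPm.ne_top
      rw [Ideal.eq_top_iff_one]
      obtain ⟨π, hπ⟩ := (IsPrincipalIdealRing.principal (q.under A)).principal
      have : C π ∣ f.primPart := by
        rw [C_dvd_iff_dvd_coeff]
        intro i
        have := congrArg (fun g => g.coeff i) h0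
        simp only [coeff_map, coeff_zero] at this
        rw [Ideal.Quotient.algebraMap_eq, Ideal.Quotient.eq_zero_iff_mem, hπ] at this
        exact Ideal.mem_span_singleton.mp this
      have := f.isPrimitive_primPart π this
      rw [hπ]
      have h := Ideal.span_singleton_eq_top.mpr this
      exact (Ideal.eq_top_iff_one _).mp h
    · rw [aeval_map_algebraMap]
      have : Ideal.Quotient.mk q x = Ideal.Quotient.mkₐ A q x := rfl
      rw [this, aeval_algHom_apply, h1, map_zero]
  have : Algebra.IsIntegral (A ⧸ q.under A) (D ⧸ q) := inferInstance
  have := isField_of_isIntegral_of_isField' (R := A ⧸ q.under A) (S := D ⧸ q) (Field.toIsField _)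
  exact Ideal.Quotient.maximal_of_isField _ this

lemma all_maximal {A D : Type*} [CommRing A] [IsDomain A] [IsPrincipalIdealRing A]
    [CommRing D] [IsDomain D] [IsNoetherianRing D] [Algebra A D] [Algebra.FiniteType A D]
    (hinj : Function.Injective (algebraMap A D))
    (m : Ideal D) [hm : m.IsMaximal] (hh : ∀ q : Ideal D, q.IsPrime → q < m → q = ⊥)
    (π : A) (hπ : π ≠ 0) (hπm : algebraMap A D π ∈ m)
    (q : Ideal D) [q.IsPrime] (hq : q ≠ ⊥) : q.IsMaximal := by
  classical
  have hfin := Ideal.finite_minimalPrimes_of_isNoetherianRing D (Ideal.span {algebraMap A D π})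
  have hf : ∃ f ∉ m, ∀ n ∈ (Ideal.span {algebraMap A D π}).minimalPrimes, n ≠ m → f ∈ n := by
    by_contra hcon
    push Not at hcon
    have hle : (hfin.toFinset.erase m).inf id ≤ m := by
      intro f hf
      by_contra hfm
      obtain ⟨n, hn, hnm, hfn⟩ := hcon f hfm
      exact hfn ((Finset.inf_le (f := id) (by simp [hn, hnm] : n ∈ hfin.toFinset.erase m)) hf)
    obtain ⟨n, hn, hnm⟩ := (Ideal.IsPrime.inf_le' hm.isPrime).mp hle
    simp only [Finset.mem_erase, Set.Finite.mem_toFinset, id] at hn hnm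
    have h0 := hh n hn.2.1.1 (lt_of_le_of_ne hnm hn.1)
    have : algebraMap A D π ∈ n := hn.2.1.2 (Ideal.mem_span_singleton_self _)
    rw [h0, Ideal.mem_bot] at this
    exact hπ (hinj (by simpa using this))
  obtain ⟨f, hfm, hf⟩ := hf
  have : Algebra.QuasiFiniteAt A m := by
    refine Algebra.QuasiFiniteAt.of_isOpen_singleton_fiber (⟨m, hm.isPrime⟩ : PrimeSpectrum D) ?_
    rw [isOpen_induced_iff]
    refine ⟨PrimeSpectrum.basicOpen f, (PrimeSpectrum.basicOpen f).isOpen, ?_⟩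
    ext ⟨x, hx⟩
    simp only [Set.mem_preimage, SetLike.mem_coe, PrimeSpectrum.mem_basicOpen,
      Set.mem_singleton_iff] at hx ⊢
    constructor
    · intro hfx
      have hπx : algebraMap A D π ∈ x.asIdeal := by
        have : π ∈ (PrimeSpectrum.comap (algebraMap A D) x).asIdeal := by
          rw [hx]; exact hπm
        exact this
      obtain ⟨n, hn, hnx⟩ := Ideal.exists_minimalPrimes_le (J := x.asIdeal)
        (I := Ideal.span {algebraMap A D π}) (by simpa [Ideal.span_le] using hπx)
      have : n = m := by
        by_contra hne
        exact hfx (hnx (hf n hn hne))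
      subst this
      exact Subtype.ext (PrimeSpectrum.ext (hm.eq_of_le x.2.ne_top hnx).symm)
    · intro h
      have h' : x = ⟨m, hm.isPrime⟩ := congrArg Subtype.val h
      rw [h']
      exact hfm
  obtain ⟨r, hrm, hr, hint⟩ := (Algebra.zariskisMainProperty_iff (R := A)).mp
    (Algebra.ZariskisMainProperty.of_finiteType (R := A) m)
  have hr0 : r ≠ 0 := by rintro rfl; exact hrm m.zero_mem
  have : Algebra.IsAlgebraic A D := by
    constructor
    intro x
    obtain ⟨k, hk⟩ := hint x
    have h1 := hk.isAlgebraic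
    have h2 := (hr.pow k).isAlgebraic
    exact IsAlgebraic.of_mul (mem_nonZeroDivisors_of_ne_zero (pow_ne_zero k hr0)) h2 h1
  exact maximal_of_algebraic hinj q hq

lemma infinite_quotient_aux {D : Type*} [CommRing D] [IsDomain D] (hft : Algebra.FiniteType ℤ D)
    (hdim : 2 ≤ ringKrullDim D) (a : D) (ha : a ≠ 0) (hat : Ideal.span {a} ≠ ⊤) :
    Infinite (D ⧸ Ideal.span {a}) := by
  by_contra hinf
  rw [not_infinite_iff_finite] at hinf
  have : IsNoetherianRing D := Algebra.FiniteType.isNoetherianRing ℤ D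
  obtain ⟨m, hm, ham⟩ := Ideal.exists_le_maximal _ hat
  have ham' : a ∈ m := ham (Ideal.mem_span_singleton_self a)
  have hfinq : ∀ q : Ideal D, Ideal.span {a} ≤ q → Finite (D ⧸ q) := fun q hq =>
    Finite.of_surjective _ (Ideal.Quotient.factor_surjective hq)
  have hmmin : m ∈ (Ideal.span {a}).minimalPrimes := by
    refine ⟨⟨hm.isPrime, ham⟩, ?_⟩
    rintro q ⟨hq, haq⟩ hqm
    have := hfinq q haq
    have hqmax : q.IsMaximal :=
      Ideal.Quotient.maximal_of_isField _ (Finite.isField_of_domain (D ⧸ q))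
    exact (hqmax.eq_of_le hm.ne_top hqm).ge
  have hh1 := Ideal.height_le_one_of_isPrincipal_of_mem_minimalPrimes _ m hmmin
  have hh : ∀ q : Ideal D, q.IsPrime → q < m → q = ⊥ := by
    intro q hq hqm
    have h := (Ideal.height_le_iff (n := 1)).mp (by exact_mod_cast hh1) q hq hqm
    exact Ideal.height_eq_zero_iff_eq_bot.mp (by simpa using h)
  have key : ∀ q : Ideal D, q.IsPrime → q ≠ ⊥ → q.IsMaximal := by
    rcases CharP.exists D with ⟨c, hc⟩
    rcases Nat.eq_zero_or_pos c with rfl | hpos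
    · have : CharZero D := CharP.charP_to_charZero D
      have := hfinq m ham
      intro q hq hq0
      refine all_maximal (A := ℤ) (algebraMap ℤ D).injective_int m hh (Nat.card (D ⧸ m))
        (by exact_mod_cast Nat.card_pos.ne') ?_ q hq0
      rw [← Ideal.Quotient.eq_zero_iff_mem]
      have h := card_nsmul_eq_zero' (x := (1 : D ⧸ m))
      simpa using h
    · have : Fact c.Prime := ⟨(CharP.char_is_prime_or_zero D c).resolve_right hpos.ne'⟩
      let _ : Algebra (ZMod c) D := ZMod.algebra D c
      have htr : Transcendental (ZMod c) a := by
        intro halg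
        have hu : IsUnit a := IsArtinianRing.isUnit_of_isIntegral_of_nonZeroDivisor
          halg.isIntegral (mem_nonZeroDivisors_of_ne_zero ha)
        exact hat (Ideal.span_singleton_eq_top.mpr hu)
      let _ : Algebra (ZMod c)[X] D := (aeval (R := ZMod c) a).toRingHom.toAlgebra
      have : Algebra.FiniteType (ZMod c)[X] D :=
        Algebra.FiniteType.of_restrictScalars_finiteType ℤ _ _
      intro q hq hq0
      refine all_maximal (A := (ZMod c)[X]) (transcendental_iff_injective.mp htr) m hh X
        X_ne_zero ?_ q hq0
      change aeval a X ∈ m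
      simpa using ham'
  have : Ring.DimensionLEOne D := ⟨fun {q} hq0 hq => key q hq hq0⟩
  have hle : ringKrullDim D ≤ 1 := by
    have : Ring.KrullDimLE 1 D := inferInstance
    exact_mod_cast Order.krullDimLE_iff _ _ |>.mp this
  exact absurd (hdim.trans hle) (by decide)


/-- Let `D = R_d/p` be an integral domain, the quotient of the Laurent
polynomial ring `R_d = ℤ[u₁^{±1},…,u_d^{±1}]` (the group algebra of `ℤ^d` over
`ℤ`) by a prime ideal `p` of coheight at least `2`, i.e. `dim D ≥ 2`. Then for
every nonzero proper principal ideal `(a) ⊆ D`, the quotient `D/(a)` is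
infinite. -/
theorem infinite_quotient_of_dim_ge_two
    (d : ℕ) (p : Ideal (AddMonoidAlgebra ℤ (Fin d → ℤ))) [p.IsPrime]
    (hdim : 2 ≤ ringKrullDim (AddMonoidAlgebra ℤ (Fin d → ℤ) ⧸ p)) :
    ∀ a : AddMonoidAlgebra ℤ (Fin d → ℤ) ⧸ p, a ≠ 0 →
      Ideal.span {a} ≠ ⊤ →
      Infinite ((AddMonoidAlgebra ℤ (Fin d → ℤ) ⧸ p) ⧸ Ideal.span {a}) := by
  intro a ha hat
  have h1 : Algebra.FiniteType ℤ (AddMonoidAlgebra ℤ (Fin d → ℤ)) := inferInstance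
  have h2 := h1.of_surjective (Ideal.Quotient.mkₐ ℤ p) Ideal.Quotient.mk_surjective
  refine infinite_quotient_aux ?_ hdim a ha hat
  convert! h2
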